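/- Let n ≥ 1 be an integer and let ξ ∈ F_q((T^{-1})) be algebraic over F_q(T) of degree d. Then w_n(ξ) ≤ d − 1 and w_n*(ξ) ≤ d − 1. -/

import Mathlib

open Polynomial Filter Set
open scoped Classical

noncomputable section

namespace OotoT

variable (Fq : Type) [Field Fq]

/-- We model the field `F_q((T⁻¹))` of Laurent series in `T⁻¹` as `LaurentSeries Fq`,
whose canonical variable `u` plays the role of `T⁻¹`.  Thus `T` itself is `u⁻¹`. -/
def Tel : LaurentSeries Fq := (HahnSeries.single (1 : ℤ) (1 : Fq))⁻¹

/-- The canonical ring embedding `F_q[T] → F_q((T⁻¹))`, sending `T ↦ u⁻¹`. -/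
def ringHomT : Polynomial Fq →+* LaurentSeries Fq :=
  Polynomial.eval₂RingHom (HahnSeries.C : Fq →+* LaurentSeries Fq) (Tel Fq)

/-- The absolute value on `F_q((T⁻¹))`: `|0| = 0` and `|ξ| = q^{-N}` where
`ξ = Σ_{n ≥ N} a_n T^{-n}` with `a_N ≠ 0`; in our model `N` is the order of `ξ`
as a Hahn series in `u = T⁻¹`. -/
def absL (q : ℕ) (ξ : LaurentSeries Fq) : ℝ :=
  if ξ = 0 then 0 else (q : ℝ) ^ (-ξ.order)

/-- Evaluation of a polynomial `P(X) ∈ (F_q[T])[X]` at `ξ ∈ F_q((T⁻¹))`. -/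
def evalP (ξ : LaurentSeries Fq) (P : Polynomial (Polynomial Fq)) : LaurentSeries Fq :=
  Polynomial.eval₂ (ringHomT Fq) ξ P

/-- The height of `P(X) ∈ (F_q[T])[X]`: the maximum of the absolute values of its
coefficients.  A nonzero `c ∈ F_q[T]` has `|c| = q^{deg c}`, so for `P ≠ 0` the height
is `q` raised to the maximal degree of a (nonzero) coefficient of `P`. -/
def heightP (q : ℕ) (P : Polynomial (Polynomial Fq)) : ℝ :=
  if P = 0 then 0 else (q : ℝ) ^ (P.support.sup fun i => (P.coeff i).natDegree)

/-- `w_n(ξ)`: the supremum (in the extended reals) of the real numbers `w` such that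
`0 < |P(ξ)| ≤ H(P)^{-w}` for infinitely many `P(X) ∈ (F_q[T])[X]` of degree at most `n`. -/
def wn (q : ℕ) (n : ℕ) (ξ : LaurentSeries Fq) : EReal :=
  sSup ((fun w : ℝ => (w : EReal)) ''
    {w : ℝ | {P : Polynomial (Polynomial Fq) | P.natDegree ≤ n ∧
      0 < absL Fq q (evalP Fq ξ P) ∧
      absL Fq q (evalP Fq ξ P) ≤ heightP Fq q P ^ (-w)}.Infinite})

/-- `w(ξ) = limsup_{n→∞} w_n(ξ)/n`. -/
def wB (q : ℕ) (ξ : LaurentSeries Fq) : EReal :=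
  Filter.limsup (fun n : ℕ => wn Fq q n ξ / (n : EReal)) Filter.atTop

/-- `ξ` is an `A`-number if `w(ξ) = 0`. -/
def IsANumber (q : ℕ) (ξ : LaurentSeries Fq) : Prop := wB Fq q ξ = 0

/-- `ξ` is an `S`-number if `0 < w(ξ) < +∞`. -/
def IsSNumber (q : ℕ) (ξ : LaurentSeries Fq) : Prop := 0 < wB Fq q ξ ∧ wB Fq q ξ < ⊤

/-- `ξ` is a `T`-number if `w(ξ) = +∞` and `w_n(ξ) < +∞` for all `n ≥ 1`. -/
def IsTNumber (q : ℕ) (ξ : LaurentSeries Fq) : Prop :=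
  wB Fq q ξ = ⊤ ∧ ∀ n : ℕ, 1 ≤ n → wn Fq q n ξ < ⊤

/-- `ξ` is a `U`-number if `w(ξ) = +∞` and `w_n(ξ) = +∞` for some `n ≥ 1`. -/
def IsUNumber (q : ℕ) (ξ : LaurentSeries Fq) : Prop :=
  wB Fq q ξ = ⊤ ∧ ∃ n : ℕ, 1 ≤ n ∧ wn Fq q n ξ = ⊤

/-- The type `t(ξ) = limsup_{n→∞} (log w_n(ξ))/(log n)` of a `T`-number (as an
extended real; for a `T`-number each `w_n(ξ)` is a finite real, recovered by `toReal`). -/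
def typeT (q : ℕ) (ξ : LaurentSeries Fq) : EReal :=
  Filter.limsup
    (fun n : ℕ => ((Real.log (wn Fq q n ξ).toReal / Real.log n : ℝ) : EReal)) Filter.atTop

/-! ### The algebraic closure side -/

/-- The algebraic closure of `F_q((T⁻¹))`. -/
abbrev AC := AlgebraicClosure (LaurentSeries Fq)

/-- The canonical embedding of `F_q((T⁻¹))` into its algebraic closure. -/
def iota : LaurentSeries Fq →+* AC Fq := algebraMap _ _

/-- The embedding `F_q[T] → AC`. -/
def ringHomTC : Polynomial Fq →+* AC Fq := (iota Fq).comp (ringHomT Fq)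

/-- Evaluation of `P(X) ∈ (F_q[T])[X]` at an element of the algebraic closure. -/
def evalPC (α : AC Fq) (P : Polynomial (Polynomial Fq)) : AC Fq :=
  Polynomial.eval₂ (ringHomTC Fq) α P

/-- `P ∈ (F_q[T])[X]` is *the* minimal polynomial of `α`: it is non-constant, irreducible,
primitive, its leading coefficient is monic (in `T`), and `P(α) = 0`.  For `α` algebraic
over `F_q(T)` such a polynomial exists and is unique. -/
def IsMinPolyOf (α : AC Fq) (P : Polynomial (Polynomial Fq)) : Prop :=
  0 < P.natDegree ∧ Irreducible P ∧ P.IsPrimitive ∧ P.leadingCoeff.Monic ∧ evalPC Fq α P = 0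

/-- `α` is algebraic over `F_q(T)`. -/
def IsAlgT (α : AC Fq) : Prop := ∃ P, IsMinPolyOf Fq α P

/-- The degree of an algebraic `α`: the degree of its minimal polynomial. -/
def degT (α : AC Fq) : ℕ := if h : IsAlgT Fq α then h.choose.natDegree else 0

/-- The height of an algebraic `α`: the height of its minimal polynomial. -/
def heightT (q : ℕ) (α : AC Fq) : ℝ := if h : IsAlgT Fq α then heightP Fq q h.choose else 0

/-- The unique extension of the absolute value to the algebraic closure of `F_q((T⁻¹))`,
given by the standard formula `|x| = |N_{K(x)/K}(x)|^{1/[K(x):K]}`, i.e.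
`|x| = |c₀|^{1/d}` where `c₀` is the constant coefficient and `d` the degree of the
minimal polynomial of `x` over `K = F_q((T⁻¹))`. -/
def absC (q : ℕ) (x : AC Fq) : ℝ :=
  absL Fq q ((minpoly (LaurentSeries Fq) x).coeff 0) ^
    (((minpoly (LaurentSeries Fq) x).natDegree : ℝ)⁻¹)

/-- `w_n^*(ξ)`: the supremum (in the extended reals) of the real numbers `w` such that
`0 < |ξ - α| ≤ H(α)^{-w-1}` for infinitely many `α` algebraic over `F_q(T)` of degree
at most `n`. -/
def wnStar (q : ℕ) (n : ℕ) (ξ : LaurentSeries Fq) : EReal :=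
  sSup ((fun w : ℝ => (w : EReal)) ''
    {w : ℝ | {α : AC Fq | IsAlgT Fq α ∧ degT Fq α ≤ n ∧
      0 < absC Fq q (iota Fq ξ - α) ∧
      absC Fq q (iota Fq ξ - α) ≤ heightT Fq q α ^ (-w - 1)}.Infinite})

/-- `w^*(ξ) = limsup_{n→∞} w_n^*(ξ)/n`. -/
def wBStar (q : ℕ) (ξ : LaurentSeries Fq) : EReal :=
  Filter.limsup (fun n : ℕ => wnStar Fq q n ξ / (n : EReal)) Filter.atTop

/-- `ξ` is an `A*`-number if `w^*(ξ) = 0`. -/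
def IsAStarNumber (q : ℕ) (ξ : LaurentSeries Fq) : Prop := wBStar Fq q ξ = 0

/-- `ξ` is a `T*`-number if `w^*(ξ) = +∞` and `w_n^*(ξ) < +∞` for all `n ≥ 1`. -/
def IsTStarNumber (q : ℕ) (ξ : LaurentSeries Fq) : Prop :=
  wBStar Fq q ξ = ⊤ ∧ ∀ n : ℕ, 1 ≤ n → wnStar Fq q n ξ < ⊤

/-- The `*`-type `t^*(ξ) = limsup_{n→∞} (log w_n^*(ξ))/(log n)` of a `T*`-number. -/
def typeTStar (q : ℕ) (ξ : LaurentSeries Fq) : EReal :=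
  Filter.limsup
    (fun n : ℕ => ((Real.log (wnStar Fq q n ξ).toReal / Real.log n : ℝ) : EReal)) Filter.atTop

/-! ### The Laurent series `ξ(r, m)` -/

/-- `r_j = r^{m_0 m_1 ⋯ m_j}`. -/
def rr (r : ℕ) (m : ℕ → ℕ) (j : ℕ) : ℕ := r ^ (∏ i ∈ Finset.range (j + 1), m i)

/-- `α_j(r, m) = Σ_{n=1}^∞ T^{-r_j^n}`, i.e. the power series in `u = T⁻¹` whose
`k`-th coefficient is `1` exactly when `k = r_j^n` for some `n ≥ 1`. -/
def alphaJ (r : ℕ) (m : ℕ → ℕ) (j : ℕ) : LaurentSeries Fq :=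
  HahnSeries.ofPowerSeries ℤ Fq (PowerSeries.mk fun k =>
    if ∃ n : ℕ, 1 ≤ n ∧ k = rr r m j ^ n then 1 else 0)

/-- `ξ_a(r, m) = Σ_{j=0}^∞ a_j α_j(r, m)`, described coefficientwise: the coefficient of
`T^{-k}` is the (finite) sum over `j` of `a_j` times the coefficient of `T^{-k}` in
`α_j(r, m)`. -/
def xiA (r : ℕ) (m : ℕ → ℕ) (a : ℕ → ℕ) : LaurentSeries Fq :=
  HahnSeries.ofPowerSeries ℤ Fq (PowerSeries.mk fun k =>
    ∑ᶠ j : ℕ, (a j : Fq) * (if ∃ n : ℕ, 1 ≤ n ∧ k = rr r m j ^ n then 1 else 0))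

/-- `ξ(r, m) = Σ_{j=0}^∞ α_j(r, m)`. -/
def xi (r : ℕ) (m : ℕ → ℕ) : LaurentSeries Fq := xiA Fq r m fun _ => 1

/-! ### Algebraicity and algebraic dependence over `F_q(T)` for Laurent series -/

/-- `ξ ∈ F_q((T⁻¹))` is algebraic over `F_q(T)`. -/
def IsAlgLS (ξ : LaurentSeries Fq) : Prop :=
  ∃ P : Polynomial (Polynomial Fq), P ≠ 0 ∧ evalP Fq ξ P = 0

/-- Evaluation of a two-variable polynomial `F(X, Y) ∈ (F_q[T])[X, Y]` (coded as an
iterated polynomial ring, `T` innermost, then `X`, then `Y`) at `(ξ, η)`. -/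
def evalXY (ξ η : LaurentSeries Fq) (F : Polynomial (Polynomial (Polynomial Fq))) :
    LaurentSeries Fq :=
  Polynomial.eval₂ (Polynomial.eval₂RingHom (ringHomT Fq) ξ) η F

/-- `ξ` and `η` are algebraically dependent over `F_q(T)`. -/
def AlgDep (ξ η : LaurentSeries Fq) : Prop :=
  ∃ F : Polynomial (Polynomial (Polynomial Fq)), F ≠ 0 ∧ evalXY Fq ξ η F = 0

/-- `deg_X` of `F(X, Y) ∈ (F_q[T])[X, Y]` in our encoding. -/
def degX (F : Polynomial (Polynomial (Polynomial Fq))) : ℕ :=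
  F.support.sup fun i => (F.coeff i).natDegree

/-- `F(X, Y) ∈ (F_q[T])[X, Y]` is primitive (in `X` and `Y`): no non-unit of `F_q[T]`
divides all of its coefficients. -/
def IsPrimitiveXY (F : Polynomial (Polynomial (Polynomial Fq))) : Prop :=
  ∀ c : Polynomial Fq, (∀ i j : ℕ, c ∣ ((F.coeff i).coeff j)) → IsUnit c

end OotoT

namespace OotoT

section Nonarchimedean

variable {K : Type*} [Field K] {v : AbsoluteValue K ℝ}

theorem abv_sum_le_of_forall_le (hv : IsNonarchimedean v) {ι : Type*} {s : Finset ι} {f : ι → K}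
    {B : ℝ} (hB : 0 ≤ B) (h : ∀ i ∈ s, v (f i) ≤ B) : v (∑ i ∈ s, f i) ≤ B := by
  induction s using Finset.induction_on with
  | empty => simpa
  | insert a s ha ih =>
    rw [Finset.sum_insert ha]
    exact (hv _ _).trans (max_le (h a (by simp)) (ih fun i hi => h i (by simp [hi])))

/-- The Leibniz formula bounds a determinant by the product of bounds for its rows. -/
theorem abv_det_le_prod (hv : IsNonarchimedean v) {ι : Type*} [Fintype ι] [DecidableEq ι]
    (M : Matrix ι ι K) (b : ι → ℝ) (hM : ∀ i j, v (M i j) ≤ b i) : v M.det ≤ ∏ i, b i := by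
  have hb : ∀ i, 0 ≤ b i := fun i => (v.nonneg _).trans (hM i i)
  rw [Matrix.det_apply]
  refine abv_sum_le_of_forall_le hv (Finset.prod_nonneg fun i _ => hb i) fun σ _ => ?_
  have hsign : v (Equiv.Perm.sign σ • ∏ i, M (σ i) i) = v (∏ i, M (σ i) i) := by
    rcases Int.units_eq_one_or (Equiv.Perm.sign σ) with h | h <;> simp [h, Units.smul_def]
  rw [hsign, map_prod, ← Equiv.prod_comp σ b]
  exact Finset.prod_le_prod (fun _ _ => v.nonneg _) fun i _ => hM _ _

theorem abv_adjugate_le (hv : IsNonarchimedean v) {d : ℕ} (M : Matrix (Fin d) (Fin d) K) {b : ℝ}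
    (hM : ∀ i j, v (M i j) ≤ b) (i j : Fin d) : v (M.adjugate i j) ≤ b ^ (d - 1) := by
  rw [Matrix.adjugate_apply]
  refine (abv_det_le_prod hv _ (fun k => if k = j then 1 else b) fun k l => ?_).trans_eq ?_
  · by_cases hk : k = j
    · subst hk
      by_cases hl : l = i
      · subst hl; simp
      · simp [hl]
    · simpa [Matrix.updateRow_ne hk, hk] using hM k l
  · rw [Finset.prod_ite, Finset.prod_const_one, one_mul, Finset.prod_const, Finset.filter_ne',
      Finset.card_erase_of_mem (Finset.mem_univ _), Finset.card_univ, Fintype.card_fin]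

end Nonarchimedean

/-- Pseudo-division with remainder by a polynomial of positive degree. -/
theorem exists_pseudo_div {R : Type*} [CommRing R] (Q : R[X]) (hQ : 0 < Q.natDegree)
    (N : ℕ) (S : R[X]) (hS : S.natDegree ≤ N) :
    ∃ s r : R[X], C (Q.leadingCoeff ^ N) * S = Q * s + r ∧ r.natDegree < Q.natDegree := by
  induction N generalizing S with
  | zero => exact ⟨0, S, by simp, by omega⟩
  | succ N ih =>
    obtain ⟨s, r, h, hr⟩ := ih S.divX (by rw [natDegree_divX_eq_natDegree_tsub_one]; omega)
    obtain ⟨m, hm⟩ : ∃ m, Q.natDegree = m + 1 := ⟨Q.natDegree - 1, by omega⟩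
    refine ⟨C Q.leadingCoeff * X * s + C (r.coeff m),
      C Q.leadingCoeff * X * r - C (r.coeff m) * Q + C (Q.leadingCoeff ^ (N + 1) * S.coeff 0),
      ?_, ?_⟩
    · conv_lhs => rw [← S.divX_mul_X_add]
      simp only [pow_succ, C_mul] at h ⊢
      linear_combination (C Q.leadingCoeff * X) * h
    · rw [hm, Nat.lt_succ_iff, natDegree_le_iff_coeff_eq_zero]
      intro k hk
      obtain ⟨l, rfl⟩ : ∃ l, k = l + 1 := ⟨k - 1, by omega⟩
      simp only [coeff_add, coeff_sub, mul_assoc, coeff_C_mul, coeff_X_mul, coeff_C_succ, add_zero]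
      rcases eq_or_ne l m with rfl | hl
      · rw [← hm, coeff_natDegree]; ring
      · rw [coeff_eq_zero_of_natDegree_lt (p := r) (by omega),
          coeff_eq_zero_of_natDegree_lt (p := Q) (by omega)]
        simp

section Liouville

variable {R K : Type*} [CommRing R] [IsDomain R] [Field K] {v : AbsoluteValue K ℝ} {φ : R →+* K}

/-- Liouville's inequality at an algebraic element `ξ` of degree `Q.natDegree`, when nonzero
elements of `R` have absolute value at least `1`. -/
theorem exists_liouville_bound (hv : IsNonarchimedean v) (hφ : ∀ r : R, r ≠ 0 → 1 ≤ v (φ r))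
    (ξ : K) (Q : R[X]) (hQ : 0 < Q.natDegree) (hQξ : Q.eval₂ φ ξ = 0)
    (hmin : ∀ P : R[X], P.natDegree < Q.natDegree → P.eval₂ φ ξ = 0 → P = 0) (n : ℕ) :
    ∃ A : ℝ, 0 < A ∧ ∀ (P : R[X]) (H : ℝ), P.natDegree ≤ n → (∀ i, v (φ (P.coeff i)) ≤ H) →
      P.eval₂ φ ξ ≠ 0 → 1 ≤ A * v (P.eval₂ φ ξ) * H ^ (Q.natDegree - 1) := by
  set d := Q.natDegree
  set N := n + d
  have hdiv : ∀ i : ℕ, ∃ r : R[X], r.natDegree < d ∧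
      (i ≤ N → φ (Q.leadingCoeff ^ N) * ξ ^ i = r.eval₂ φ ξ) := fun i => by
    by_cases hi : i ≤ N
    · obtain ⟨s, r, h, hr⟩ := exists_pseudo_div Q hQ N (X ^ i) (by simpa using hi)
      refine ⟨r, hr, fun _ => ?_⟩
      have := congrArg (eval₂ φ ξ) h
      rwa [eval₂_mul, eval₂_add, eval₂_mul, eval₂_C, eval₂_X_pow, hQξ, zero_mul, zero_add] at this
    · exact ⟨0, by simpa using hQ, fun h => absurd h hi⟩
  choose r hrd hr using hdiv
  set B : ℝ := ∑ i ∈ Finset.range (N + 1), ∑ k ∈ Finset.range d, v (φ ((r i).coeff k))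
  have hB : ∀ i ≤ N, ∀ k < d, v (φ ((r i).coeff k)) ≤ B := fun i hi k hk =>
    (Finset.single_le_sum (f := fun k => v (φ ((r i).coeff k))) (fun _ _ => v.nonneg _)
      (Finset.mem_range.2 hk)).trans
    (Finset.single_le_sum (f := fun i => ∑ k ∈ Finset.range d, v (φ ((r i).coeff k)))
      (fun _ _ => Finset.sum_nonneg fun _ _ => v.nonneg _)
      (Finset.mem_range.2 (Nat.lt_succ_of_le hi)))
  have hB0 : 0 ≤ B := (v.nonneg _).trans (hB 0 (Nat.zero_le _) 0 hQ)
  set L := max 1 (v ξ)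
  have hL : 1 ≤ L := le_max_left _ _
  have hlead : Q.leadingCoeff ≠ 0 := leadingCoeff_ne_zero.2 (ne_zero_of_natDegree_gt hQ)
  set a := φ (Q.leadingCoeff ^ N)
  have ha : 1 ≤ v a := hφ _ (pow_ne_zero _ hlead)
  refine ⟨v a * (B + 1) ^ (d - 1) * L ^ d, by positivity, fun P H hP hH hPξ => ?_⟩
  have hH0 : 0 ≤ H := (v.nonneg _).trans (hH 0)
  let M : Matrix (Fin d) (Fin d) R := fun j k =>
    ∑ i ∈ Finset.range (n + 1), P.coeff i * (r (i + j)).coeff k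
  let x : Fin d → K := fun k => ξ ^ (k : ℕ)
  have hMx : ∀ j : Fin d, ∑ k, φ (M j k) * x k = a * P.eval₂ φ ξ * x j := by
    intro j
    calc ∑ k, φ (M j k) * x k
        = ∑ i ∈ Finset.range (n + 1), φ (P.coeff i) * (r (i + j)).eval₂ φ ξ := by
          simp only [M, map_sum, map_mul, Finset.sum_mul]
          rw [Finset.sum_comm]
          refine Finset.sum_congr rfl fun i _ => ?_
          rw [eval₂_eq_sum_range' φ (hrd (i + j)), Finset.mul_sum, Finset.sum_range]
          exact Finset.sum_congr rfl fun k _ => by ring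
      _ = ∑ i ∈ Finset.range (n + 1), φ (P.coeff i) * (a * ξ ^ (i + j)) := by
          refine Finset.sum_congr rfl fun i hi => ?_
          rw [hr (i + j) (by have := j.2; have := Finset.mem_range.1 hi; omega)]
      _ = a * P.eval₂ φ ξ * x j := by
          rw [eval₂_eq_sum_range' φ (Nat.lt_succ_of_le hP), Finset.mul_sum, Finset.sum_mul]
          exact Finset.sum_congr rfl fun i _ => by simp only [x]; ring
  have hdet : M.det ≠ 0 := by
    intro h0
    obtain ⟨w, hw, hwM⟩ := Matrix.exists_vecMul_eq_zero_iff.2 h0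
    have hwx : ∑ j, φ (w j) * x j = 0 := by
      have h1 : a * P.eval₂ φ ξ * ∑ j, φ (w j) * x j = 0 := by
        calc a * P.eval₂ φ ξ * ∑ j, φ (w j) * x j
            = ∑ j, φ (w j) * ∑ k, φ (M j k) * x k := by
              rw [Finset.mul_sum]
              exact Finset.sum_congr rfl fun j _ => by rw [hMx]; ring
          _ = ∑ k, φ (∑ j, w j * M j k) * x k := by
              simp only [Finset.mul_sum, map_sum, map_mul, Finset.sum_mul]
              rw [Finset.sum_comm]
              exact Finset.sum_congr rfl fun j _ => Finset.sum_congr rfl fun k _ => by ring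
          _ = 0 := Finset.sum_eq_zero fun k _ => by
              have : ∑ j, w j * M j k = 0 := congrFun hwM k
              rw [this]; simp
      refine (mul_eq_zero.1 h1).resolve_left (mul_ne_zero (fun h => ?_) hPξ)
      simp [h] at ha
      linarith
    let W : R[X] := ∑ j : Fin d, C (w j) * X ^ (j : ℕ)
    have hWc : ∀ j : Fin d, W.coeff j = w j := fun j => by
      simp [W, coeff_X_pow, Fin.val_inj]
    have hW : W = 0 := by
      refine hmin W ?_ ?_
      · refine lt_of_le_of_lt (natDegree_sum_le_of_forall_le (n := d - 1) _ _ fun j _ => ?_)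
          (by omega)
        exact (natDegree_C_mul_X_pow_le _ _).trans (by have := j.2; omega)
      · simpa [W, eval₂_finsetSum, eval₂_mul] using hwx
    exact hw (funext fun j => by rw [← hWc j, hW]; simp)
  have hMb : ∀ j k, v (M.map φ j k) ≤ H * (B + 1) := fun j k => by
    rw [Matrix.map_apply, map_sum]
    refine abv_sum_le_of_forall_le hv (by positivity) fun i hi => ?_
    rw [map_mul, map_mul]
    have h2 := hB (i + j) (by have := j.2; have := Finset.mem_range.1 hi; omega) k k.2
    exact mul_le_mul (hH i) (by linarith) (v.nonneg _) hH0
  have hkey : φ M.det = a * P.eval₂ φ ξ * ∑ k, (M.map φ).adjugate ⟨0, hQ⟩ k * x k := by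
    have h1 : (M.map φ).mulVec x = (a * P.eval₂ φ ξ) • x := funext fun j => by
      simpa [Matrix.mulVec, dotProduct] using hMx j
    have h2 : (M.map φ).adjugate.mulVec ((M.map φ).mulVec x) = (M.map φ).det • x := by
      rw [Matrix.mulVec_mulVec, Matrix.adjugate_mul, Matrix.smul_mulVec, Matrix.one_mulVec]
    rw [h1, Matrix.mulVec_smul] at h2
    have h3 := congrFun h2 ⟨0, hQ⟩
    simp only [Pi.smul_apply, Matrix.mulVec, dotProduct, smul_eq_mul] at h3
    rw [h3, RingHom.map_det]
    simp [x, RingHom.mapMatrix_apply]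
  have hsum : v (∑ k, (M.map φ).adjugate ⟨0, hQ⟩ k * x k) ≤ (H * (B + 1)) ^ (d - 1) * L ^ d := by
    refine abv_sum_le_of_forall_le hv (by positivity) fun k _ => ?_
    rw [map_mul]
    refine mul_le_mul (abv_adjugate_le hv _ hMb _ _) ?_ (v.nonneg _) (by positivity)
    rw [map_pow]
    exact (pow_le_pow_left₀ (v.nonneg _) (le_max_right _ _) _).trans
      (pow_le_pow_right₀ hL k.2.le)
  calc (1 : ℝ) ≤ v (φ M.det) := hφ _ hdet
    _ = v a * v (P.eval₂ φ ξ) * v (∑ k, (M.map φ).adjugate ⟨0, hQ⟩ k * x k) := by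
      rw [hkey, map_mul, map_mul]
    _ ≤ v a * v (P.eval₂ φ ξ) * ((H * (B + 1)) ^ (d - 1) * L ^ d) := by gcongr
    _ = _ := by rw [mul_pow]; ring

end Liouville

/-- If `F` vanishes at `α`, then `F(ξ)` is controlled by the constant coefficient of the minimal
polynomial of `ξ - α`. -/
theorem abv_eval_le_of_aeval_eq_zero {K L : Type*} [Field K] [Field L] [Algebra K L]
    {v : AbsoluteValue K ℝ} (hv : IsNonarchimedean v) (F : K[X]) (ξ : K) (α : L)
    (hα : aeval α F = 0) (hint : IsIntegral K (algebraMap K L ξ - α)) {n : ℕ} {H : ℝ}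
    (hF : F.natDegree ≤ n) (hH : ∀ i, v (F.coeff i) ≤ H) :
    v (F.eval ξ) ≤
      v ((minpoly K (algebraMap K L ξ - α)).coeff 0) * (H * max 1 (v ξ) ^ n) := by
  set f := minpoly K (algebraMap K L ξ - α)
  have hH0 : 0 ≤ H := (v.nonneg _).trans (hH 0)
  set B := max 1 (v ξ)
  have hB : 1 ≤ B := le_max_left _ _
  obtain ⟨g, hg⟩ : f ∣ F.comp (C ξ - X) := minpoly.dvd _ _ (by
    rw [aeval_comp]
    simpa using hα)
  have hlin : (C ξ - X : K[X]).gaussNorm v 1 ≤ B := by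
    obtain ⟨i, hi⟩ := exists_eq_gaussNorm v 1 (C ξ - X : K[X])
    rw [hi, one_pow, mul_one]
    rcases i with _ | _ | i
    · simp [B]
    · simp [B, coeff_X]
    · simp [coeff_X]; linarith
  have hpow : ∀ i, ((C ξ - X : K[X]) ^ i).gaussNorm v 1 ≤ B ^ i := fun i => by
    induction i with
    | zero => simpa using (gaussNorm_C v 1 (1 : K)).le
    | succ i ih =>
      rw [pow_succ, pow_succ, gaussNorm_mul hv one_pos]
      exact mul_le_mul ih hlin (gaussNorm_nonneg _ _ zero_le_one) (by positivity)
  have hcomp : (F.comp (C ξ - X)).gaussNorm v 1 ≤ H * B ^ n := by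
    rw [comp, eval₂_eq_sum_range' C (Nat.lt_succ_of_le hF)]
    obtain ⟨i, hi⟩ := exists_eq_gaussNorm v 1
      (∑ i ∈ Finset.range (n + 1), C (F.coeff i) * (C ξ - X : K[X]) ^ i)
    rw [hi, one_pow, mul_one, finsetSum_coeff]
    refine abv_sum_le_of_forall_le hv (by positivity) fun j hj => ?_
    rw [coeff_C_mul, map_mul]
    refine mul_le_mul (hH j) ?_ (v.nonneg _) hH0
    have h1 := le_gaussNorm v ((C ξ - X : K[X]) ^ j) zero_le_one i
    rw [one_pow, mul_one] at h1
    exact (h1.trans (hpow j)).trans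
      (pow_le_pow_right₀ hB (Nat.lt_succ_iff.1 (Finset.mem_range.1 hj)))
  have hf : 1 ≤ f.gaussNorm v 1 := by
    simpa [(minpoly.monic hint).coeff_natDegree, f] using le_gaussNorm v f zero_le_one f.natDegree
  have hg1 : g.gaussNorm v 1 ≤ H * B ^ n := by
    rw [hg, gaussNorm_mul hv one_pos] at hcomp
    exact (le_mul_of_one_le_left (gaussNorm_nonneg _ _ zero_le_one) hf).trans hcomp
  have hg0 : v (g.coeff 0) ≤ H * B ^ n := by
    simpa using (le_gaussNorm v g zero_le_one 0).trans hg1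
  have heval : F.eval ξ = f.coeff 0 * g.coeff 0 := by
    rw [← mul_coeff_zero, ← hg, coeff_zero_eq_eval_zero]
    simp [eval_comp]
  rw [heval, map_mul]
  gcongr

/-- An irreducible polynomial vanishing at `ξ` divides any polynomial of minimal positive degree
vanishing at `ξ`. -/
theorem irreducible_dvd_of_eval₂_eq_zero {R K : Type*} [CommRing R] [IsDomain R]
    [UniqueFactorizationMonoid R] [Field K] {φ : R →+* K} {ξ : K} {P Q : R[X]}
    (hQ : 0 < Q.natDegree) (hQξ : Q.eval₂ φ ξ = 0)
    (hmin : ∀ S : R[X], S.natDegree < Q.natDegree → S.eval₂ φ ξ = 0 → S = 0)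
    (hP : Irreducible P) (hPξ : P.eval₂ φ ξ = 0) : P ∣ Q := by
  obtain ⟨s, r, h, hr⟩ := exists_pseudo_div Q hQ _ P le_rfl
  have hr0 : r = 0 := hmin r hr (by
    simpa [eval₂_mul, eval₂_add, hQξ, hPξ] using (congrArg (eval₂ φ ξ) h).symm)
  rw [hr0, add_zero] at h
  refine (hP.prime.dvd_or_dvd ⟨_, by rw [← h, mul_comm]⟩ : P ∣ Q ∨ P ∣ s).resolve_right ?_
  rintro ⟨t, rfl⟩
  have hQ0 : Q.leadingCoeff ^ P.natDegree ≠ 0 :=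
    pow_ne_zero _ (leadingCoeff_ne_zero.2 (ne_zero_of_natDegree_gt hQ))
  have h1 : C (Q.leadingCoeff ^ P.natDegree) = Q * t :=
    mul_right_cancel₀ hP.ne_zero (by rw [h]; ring)
  have h2 : (Q * t).natDegree = 0 := by rw [← h1, natDegree_C]
  have h3 : Q * t ≠ 0 := by rw [← h1]; simpa using hQ0
  rw [natDegree_mul (left_ne_zero_of_mul h3) (right_ne_zero_of_mul h3)] at h2
  omega

section LaurentSeries

variable (Fq : Type) [Field Fq]

theorem absL_add_le_max (q : ℕ) (hq : 1 < q) (x y : LaurentSeries Fq) :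
    absL Fq q (x + y) ≤ max (absL Fq q x) (absL Fq q y) := by
  have hq1 : (1 : ℝ) ≤ q := by exact_mod_cast hq.le
  by_cases hxy : x + y = 0
  · rw [absL, if_pos hxy, le_max_iff]
    left
    rw [absL]
    split_ifs <;> positivity
  by_cases hx : x = 0
  · simp [hx]
  by_cases hy : y = 0
  · simp [hy]
  have h := HahnSeries.min_order_le_order_add hxy
  simp only [absL, hx, hy, hxy, if_false, le_max_iff]
  rcases min_le_iff.1 h with h | h
  · exact Or.inl (zpow_le_zpow_right₀ hq1 (neg_le_neg h))
  · exact Or.inr (zpow_le_zpow_right₀ hq1 (neg_le_neg h))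

/-- The absolute value `absL` as an `AbsoluteValue`. -/
def absLAbv (q : ℕ) (hq : 1 < q) : AbsoluteValue (LaurentSeries Fq) ℝ where
  toFun := absL Fq q
  map_mul' x y := by
    have hq0 : (q : ℝ) ≠ 0 := by positivity
    by_cases hx : x = 0
    · simp [absL, hx]
    by_cases hy : y = 0
    · simp [absL, hy]
    simp only [absL, hx, hy, mul_eq_zero, or_self, if_false]
    rw [HahnSeries.order_mul hx hy, neg_add, zpow_add₀ hq0]
  nonneg' x := by
    simp only [absL]
    split_ifs <;> positivity
  eq_zero' x := by
    have hq0 : (q : ℝ) ≠ 0 := by positivity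
    by_cases hx : x = 0 <;> simp [absL, hx, zpow_ne_zero, hq0]
  add_le' x y := by
    have hnn : ∀ z, 0 ≤ absL Fq q z := fun z => by
      simp only [absL]
      split_ifs <;> positivity
    exact (absL_add_le_max Fq q hq x y).trans (max_le_add_of_nonneg (hnn x) (hnn y))

theorem isNonarchimedean_absLAbv (q : ℕ) (hq : 1 < q) : IsNonarchimedean (absLAbv Fq q hq) :=
  absL_add_le_max Fq q hq

theorem absLAbv_apply (q : ℕ) (hq : 1 < q) (x : LaurentSeries Fq) :
    absLAbv Fq q hq x = absL Fq q x := rfl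

theorem ringHomT_eq_sum (c : Fq[X]) :
    ringHomT Fq c = ∑ i ∈ Finset.range (c.natDegree + 1),
      HahnSeries.single (-(i : ℤ)) (c.coeff i) := by
  rw [ringHomT, coe_eval₂RingHom, eval₂_eq_sum_range]
  refine Finset.sum_congr rfl fun i _ => ?_
  rw [Tel, HahnSeries.inv_single, HahnSeries.single_pow, HahnSeries.C_apply,
    HahnSeries.single_mul_single]
  simp

theorem absL_ringHomT_le (q : ℕ) (hq : 1 < q) (c : Fq[X]) :
    absL Fq q (ringHomT Fq c) ≤ (q : ℝ) ^ c.natDegree := by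
  have hq1 : (1 : ℝ) ≤ q := by exact_mod_cast hq.le
  rw [ringHomT_eq_sum, ← absLAbv_apply Fq q hq]
  refine abv_sum_le_of_forall_le (isNonarchimedean_absLAbv Fq q hq) (by positivity)
    fun i hi => ?_
  rw [absLAbv_apply, absL]
  split_ifs with h
  · positivity
  · rw [HahnSeries.order_single (by simpa using h), neg_neg, zpow_natCast]
    exact pow_le_pow_right₀ hq1 (Nat.lt_succ_iff.1 (Finset.mem_range.1 hi))

theorem one_le_absL_ringHomT (q : ℕ) (hq : 1 < q) (c : Fq[X]) (hc : c ≠ 0) :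
    1 ≤ absL Fq q (ringHomT Fq c) := by
  have hq1 : (1 : ℝ) ≤ q := by exact_mod_cast hq.le
  have hcoeff : (ringHomT Fq c).coeff (-(c.natDegree : ℤ)) ≠ 0 := by
    rw [ringHomT_eq_sum, HahnSeries.coeff_sum, Finset.sum_eq_single c.natDegree]
    · simpa using hc
    · intro i _ hi
      exact HahnSeries.coeff_single_of_ne (by simpa using Ne.symm hi)
    · simp
  have hne : ringHomT Fq c ≠ 0 := fun h => by simp [h] at hcoeff
  rw [absL, if_neg hne]
  have := HahnSeries.order_le_of_coeff_ne_zero hcoeff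
  exact one_le_zpow₀ hq1 (by omega)

theorem absL_ringHomT_coeff_le_heightP (q : ℕ) (hq : 1 < q) (P : Fq[X][X]) (i : ℕ) :
    absL Fq q (ringHomT Fq (P.coeff i)) ≤ heightP Fq q P := by
  have hq1 : (1 : ℝ) ≤ q := by exact_mod_cast hq.le
  by_cases hi : P.coeff i = 0
  · rw [hi, map_zero, absL, if_pos rfl, heightP]
    split_ifs <;> positivity
  · have hP : P ≠ 0 := fun h => hi (by simp [h])
    rw [heightP, if_neg hP]
    refine (absL_ringHomT_le Fq q hq _).trans (pow_le_pow_right₀ hq1 ?_)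
    exact Finset.le_sup (f := fun i => (P.coeff i).natDegree) (mem_support_iff.2 hi)

theorem one_le_heightP (q : ℕ) (hq : 1 < q) (P : Fq[X][X]) (hP : P ≠ 0) :
    1 ≤ heightP Fq q P := by
  rw [heightP, if_neg hP]
  exact one_le_pow₀ (by exact_mod_cast hq.le)

/-- Northcott's property. -/
theorem finite_setOf_heightP_le [Finite Fq] (q : ℕ) (hq : 1 < q) (n : ℕ) (B : ℝ) :
    {P : Fq[X][X] | P.natDegree ≤ n ∧ heightP Fq q P ≤ B}.Finite := by
  obtain ⟨m, hm0, hm⟩ : ∃ m : ℕ, 0 < m ∧ B < (q : ℝ) ^ m := by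
    obtain ⟨m, hm⟩ := pow_unbounded_of_one_lt (max B 1) (by exact_mod_cast hq : (1 : ℝ) < q)
    refine ⟨m, Nat.pos_of_ne_zero ?_, (le_max_left _ _).trans_lt hm⟩
    rintro rfl
    simp at hm
  have hdeg : ∀ P : Fq[X][X], heightP Fq q P ≤ B → ∀ i, (P.coeff i).natDegree < m := by
    intro P hP i
    have hq1 : (1 : ℝ) < q := by exact_mod_cast hq
    by_cases hi : P.coeff i = 0
    · simpa [hi] using hm0
    have hP0 : P ≠ 0 := fun h => hi (by simp [h])
    rw [heightP, if_neg hP0] at hP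
    refine (pow_lt_pow_iff_right₀ hq1).1
      (lt_of_le_of_lt (pow_le_pow_right₀ hq1.le ?_) (hP.trans_lt hm))
    exact Finset.le_sup (f := fun i => (P.coeff i).natDegree) (mem_support_iff.2 hi)
  refine Set.Finite.of_injOn (f := fun P (i : Fin (n + 1)) (j : Fin m) => (P.coeff i).coeff j)
    (t := Set.univ) (fun _ _ => Set.mem_univ _) ?_ Set.finite_univ
  intro P hP S hS h
  ext i j
  by_cases hi : i < n + 1
  · by_cases hj : j < m
    · exact congrFun (congrFun h ⟨i, hi⟩) ⟨j, hj⟩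
    · rw [coeff_eq_zero_of_natDegree_lt (p := P.coeff i) (by have := hdeg P hP.2 i; omega),
        coeff_eq_zero_of_natDegree_lt (p := S.coeff i) (by have := hdeg S hS.2 i; omega)]
  · rw [coeff_eq_zero_of_natDegree_lt (p := P) (by have := hP.1; omega),
      coeff_eq_zero_of_natDegree_lt (p := S) (by have := hS.1; omega)]

theorem finite_setOf_evalPC_eq_zero (q : ℕ) (hq : 1 < q) (P : Fq[X][X]) (hP : P ≠ 0) :
    {α : AC Fq | evalPC Fq α P = 0}.Finite := by
  have hinj : Function.Injective (ringHomTC Fq) := by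
    refine (iota Fq).injective.comp ((injective_iff_map_eq_zero _).2 fun c hc => ?_)
    by_contra h
    have := one_le_absL_ringHomT Fq q hq c h
    simp [hc, absL] at this
    linarith
  have hne : P.map (ringHomTC Fq) ≠ 0 := (Polynomial.map_ne_zero_iff hinj).2 hP
  refine (P.map (ringHomTC Fq)).roots.toFinset.finite_toSet.subset fun α hα => ?_
  simpa [hne, IsRoot, eval_map, evalPC] using hα

end LaurentSeries

theorem le_rpow_inv_of_one_le_mul {A H w : ℝ} {k : ℕ} (hH : 1 ≤ H) (hw : k < w)
    (h : 1 ≤ A * H ^ (-w) * H ^ k) : H ≤ A ^ (w - k)⁻¹ := by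
  have hpos : 0 < H := by linarith
  have hA : H ^ (w - k) ≤ A := by
    rw [mul_assoc, ← Real.rpow_natCast, ← Real.rpow_add hpos,
      show -w + (k : ℝ) = -(w - k) by ring, Real.rpow_neg hpos.le] at h
    have := Real.rpow_pos_of_pos hpos (w - k)
    rwa [← div_eq_mul_inv, one_le_div this] at h
  calc H = (H ^ (w - k)) ^ (w - k)⁻¹ := (Real.rpow_rpow_inv hpos.le (by linarith)).symm
    _ ≤ A ^ (w - k)⁻¹ := by
      have : 0 ≤ (w - k)⁻¹ := inv_nonneg.2 (by linarith)
      gcongr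

end OotoT

open OotoT

/-- If `ξ ∈ F_q((T⁻¹))` is algebraic over `F_q(T)` of degree `d` (that is,
`d` is the least degree of a nonzero polynomial in `(F_q[T])[X]` vanishing at `ξ`), then
`w_n(ξ) ≤ d − 1` and `w_n^*(ξ) ≤ d − 1`. -/
theorem wn_upper_bounds_of_algebraic (p : ℕ) (hp : p.Prime) (q : ℕ)
    (hq : ∃ e : ℕ, 0 < e ∧ q = p ^ e)
    (Fq : Type) [Field Fq] [Fintype Fq] [CharP Fq p] (hcard : Fintype.card Fq = q)
    (n : ℕ) (hn : 1 ≤ n) (ξ : LaurentSeries Fq) (d : ℕ)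
    (hξ : IsLeast {k : ℕ | ∃ P : Polynomial (Polynomial Fq),
      P ≠ 0 ∧ P.natDegree = k ∧ evalP Fq ξ P = 0} d) :
    wn Fq q n ξ ≤ (((d : ℝ) - 1 : ℝ) : EReal) ∧ wnStar Fq q n ξ ≤ (((d : ℝ) - 1 : ℝ) : EReal) := by
  have hq1 : 1 < q := by
    obtain ⟨e, he, rfl⟩ := hq
    exact Nat.one_lt_pow he.ne' hp.one_lt
  obtain ⟨⟨Q, hQ0, rfl, hQξ⟩, hlow⟩ := hξ
  have hv := isNonarchimedean_absLAbv Fq q hq1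
  have hφ : ∀ c : Fq[X], c ≠ 0 → 1 ≤ absLAbv Fq q hq1 (ringHomT Fq c) :=
    one_le_absL_ringHomT Fq q hq1
  have hmin : ∀ P : Fq[X][X], P.natDegree < Q.natDegree → P.eval₂ (ringHomT Fq) ξ = 0 → P = 0 := by
    intro P hP hPξ
    by_contra h
    exact absurd (hlow ⟨P, h, rfl, hPξ⟩) (not_le.2 hP)
  have hQ : 0 < Q.natDegree := by
    by_contra h
    rw [eq_C_of_natDegree_eq_zero (Nat.eq_zero_of_not_pos h)] at hQξ hQ0
    rw [evalP, eval₂_C] at hQξ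
    have := hφ (Q.coeff 0) fun h => hQ0 (by rw [h, C_0])
    rw [hQξ, map_zero] at this
    linarith
  obtain ⟨A, hA, hLiouville⟩ := exists_liouville_bound hv hφ ξ Q hQ hQξ hmin n
  have hbound : ∀ P : Fq[X][X], P.natDegree ≤ n → evalP Fq ξ P ≠ 0 →
      1 ≤ A * absL Fq q (evalP Fq ξ P) * heightP Fq q P ^ (Q.natDegree - 1) := fun P hP hPξ =>
    hLiouville P _ hP (absL_ringHomT_coeff_le_heightP Fq q hq1 P) hPξ
  have hcast : ((Q.natDegree : ℝ) - 1) = ((Q.natDegree - 1 : ℕ) : ℝ) := by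
    rw [Nat.cast_sub hQ, Nat.cast_one]
  rw [hcast]
  set k := Q.natDegree - 1
  have hH0 : ∀ P : Fq[X][X], evalP Fq ξ P ≠ 0 → 1 ≤ heightP Fq q P := fun P hP =>
    one_le_heightP Fq q hq1 P fun h => hP (by simp [h, evalP])
  refine ⟨sSup_le ?_, sSup_le ?_⟩
  · rintro _ ⟨w, hw, rfl⟩
    refine EReal.coe_le_coe_iff.2 (not_lt.1 fun hkw => hw ?_)
    refine (finite_setOf_heightP_le Fq q hq1 n (A ^ (w - k)⁻¹)).subset ?_
    rintro P ⟨hPn, hpos, hle⟩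
    have hPξ : evalP Fq ξ P ≠ 0 := fun h => by simp [h, absL] at hpos
    have hH := hH0 P hPξ
    refine ⟨hPn, le_rpow_inv_of_one_le_mul hH hkw ((hbound P hPn hPξ).trans ?_)⟩
    gcongr
  · rintro _ ⟨w, hw, rfl⟩
    refine EReal.coe_le_coe_iff.2 (not_lt.1 fun hkw => hw ?_)
    set B := max 1 (absLAbv Fq q hq1 ξ) ^ n
    have hB : 0 < B := pow_pos (lt_max_of_lt_left one_pos) _
    have hfin := (finite_setOf_heightP_le Fq q hq1 n ((A * B) ^ (w - k)⁻¹)).inter_of_left {P | P ≠ 0}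
    refine ((hfin.insert Q).biUnion fun P hP => finite_setOf_evalPC_eq_zero Fq q hq1 P ?_).subset ?_
    · rcases hP with rfl | hP
      exacts [hQ0, hP.2]
    rintro α ⟨hα, hdeg, hpos, hle⟩
    rw [degT, dif_pos hα] at hdeg
    rw [heightT, dif_pos hα] at hle
    obtain ⟨-, hirr, -, -, hroot⟩ := hα.choose_spec
    set P := hα.choose
    rw [Set.mem_iUnion₂]
    by_cases hPξ : evalP Fq ξ P = 0
    · obtain ⟨S, hS⟩ := irreducible_dvd_of_eval₂_eq_zero hQ hQξ hmin hirr hPξ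
      refine ⟨Q, Set.mem_insert _ _, ?_⟩
      change eval₂ (ringHomTC Fq) α Q = 0
      rw [hS, eval₂_mul, show eval₂ (ringHomTC Fq) α P = 0 from hroot, zero_mul]
    refine ⟨P, Set.mem_insert_of_mem _ ⟨⟨hdeg, ?_⟩, hirr.ne_zero⟩, hroot⟩
    have hH := hH0 P hPξ
    have hint : IsIntegral (LaurentSeries Fq) (iota Fq ξ - α) :=
      Algebra.IsIntegral.isIntegral _
    have hnorm := abv_eval_le_of_aeval_eq_zero hv (P.map (ringHomT Fq)) ξ α
      (by rw [aeval_def, eval₂_map]; exact hroot) hint ((natDegree_map_le).trans hdeg)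
      (H := heightP Fq q P)
      (fun i => by rw [coeff_map]; exact absL_ringHomT_coeff_le_heightP Fq q hq1 P i)
    rw [eval_map] at hnorm
    set f := minpoly (LaurentSeries Fq) (iota Fq ξ - α)
    have hf0 : f.natDegree ≠ 0 := (minpoly.natDegree_pos hint).ne'
    have hpow : absL Fq q (f.coeff 0) = absC Fq q (iota Fq ξ - α) ^ f.natDegree :=
      (Real.rpow_inv_natCast_pow ((absLAbv Fq q hq1).nonneg _) hf0).symm
    have hk : (0 : ℝ) ≤ k := Nat.cast_nonneg _
    have hle1 : absC Fq q (iota Fq ξ - α) ≤ 1 :=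
      hle.trans (Real.rpow_le_one_of_one_le_of_nonpos hH (by linarith))
    have hcoeff : absL Fq q (f.coeff 0) ≤ heightP Fq q P ^ (-w - 1) := by
      rw [hpow]
      exact (pow_le_of_le_one hpos.le hle1 hf0).trans hle
    have hPle : absL Fq q (evalP Fq ξ P) ≤ B * heightP Fq q P ^ (-w) := by
      calc absL Fq q (evalP Fq ξ P) ≤ absL Fq q (f.coeff 0) * (heightP Fq q P * B) := hnorm
        _ ≤ heightP Fq q P ^ (-w - 1) * (heightP Fq q P * B) := by gcongr
        _ = B * heightP Fq q P ^ (-w) := by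
          rw [Real.rpow_sub_one (by positivity)]
          field_simp
    refine le_rpow_inv_of_one_le_mul hH hkw ((hbound P hdeg hPξ).trans ?_)
    rw [mul_assoc A B]
    gcongr
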